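/- Let ω₀, r, ξ be real numbers with ω₀ > 0, r > 0, r ≠ 1 and 1/√2 ≤ ξ ≤ 1, and set β = 2ξ² − 1. If (ω, γ) is a real pair satisfying n(ω, γ) = 0 and (∂n/∂ω)(ω, γ) = 0, then ω = 0 and γ² = 1. -/

import Mathlib

/-- The bivariate polynomial
`n(ω, γ) = (γ² − r⁴)ω⁴ + 2r²ω₀²β(γ² − r²)ω² + r⁴ω₀⁴(γ² − 1)`. -/
def nPoly (ω₀ r β : ℝ) (ω γ : ℝ) : ℝ :=
  (γ ^ 2 - r ^ 4) * ω ^ 4 + 2 * r ^ 2 * ω₀ ^ 2 * β * (γ ^ 2 - r ^ 2) * ω ^ 2 +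
    r ^ 4 * ω₀ ^ 4 * (γ ^ 2 - 1)

theorem hasDerivAt_nPoly (ω₀ r β ω γ : ℝ) :
    HasDerivAt (fun w => nPoly ω₀ r β w γ)
      (4 * ω * ((γ ^ 2 - r ^ 4) * ω ^ 2 + r ^ 2 * ω₀ ^ 2 * β * (γ ^ 2 - r ^ 2))) ω := by
  have h := (((hasDerivAt_pow 4 ω).const_mul (γ ^ 2 - r ^ 4)).add
    ((hasDerivAt_pow 2 ω).const_mul (2 * r ^ 2 * ω₀ ^ 2 * β * (γ ^ 2 - r ^ 2)))).add_const
    (r ^ 4 * ω₀ ^ 4 * (γ ^ 2 - 1))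
  refine h.congr_deriv ?_
  norm_num
  ring

/-- A quadratic of the shape of `n`, in the variable `y = ω²`, has no positive double root. -/
theorem no_pos_double_root {g R W β y : ℝ} (hR : 0 < R) (hR1 : R ≠ 1) (hW : 0 < W)
    (hβ : 0 ≤ β) (hy : 0 < y)
    (hd : (g - R ^ 2) * y + R * W * β * (g - R) = 0)
    (hn : (g - R ^ 2) * y ^ 2 = R ^ 2 * W ^ 2 * (g - 1)) : False := by
  have hRW : 0 < R ^ 2 * W ^ 2 := by positivity
  have hc : 0 ≤ R * W * β := by positivity
  rcases lt_trichotomy (g - R ^ 2) 0 with h | h | h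
  · have hg : g < 1 := by
      by_contra! hg
      linarith [mul_neg_of_neg_of_pos h (pow_pos hy 2),
        mul_nonneg hRW.le (sub_nonneg.2 hg)]
    have hgR : g - R < 0 := by nlinarith
    linarith [mul_neg_of_neg_of_pos h hy, mul_nonpos_of_nonneg_of_nonpos hc hgR.le]
  · rw [h, zero_mul, eq_comm, mul_eq_zero] at hn
    have hg : g - 1 = 0 := hn.resolve_left hRW.ne'
    exact hR1 (by nlinarith)
  · have hg : 1 < g := by
      by_contra! hg
      linarith [mul_pos h (pow_pos hy 2),
        mul_nonpos_of_nonneg_of_nonpos hRW.le (sub_nonpos.2 hg)]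
    have hgR : 0 < g - R := by nlinarith
    linarith [mul_pos h hy, mul_nonneg hc hgR.le]

/-- For `1/√2 ≤ ξ ≤ 1`, any real common solution `(ω, γ)` of `n = 0` and `∂n/∂ω = 0`
satisfies `ω = 0` and `γ² = 1`. -/
theorem critical_points_large_xi (ω₀ r ξ β : ℝ)
    (hω₀ : 0 < ω₀) (hr : 0 < r) (hr1 : r ≠ 1)
    (hξ₁ : 1 / Real.sqrt 2 ≤ ξ) (hξ₂ : ξ ≤ 1) (hβ : β = 2 * ξ ^ 2 - 1)
    (ω γ : ℝ) (h₁ : nPoly ω₀ r β ω γ = 0)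
    (h₂ : deriv (fun w => nPoly ω₀ r β w γ) ω = 0) :
    ω = 0 ∧ γ ^ 2 = 1 := by
  have hβ0 : 0 ≤ β := by
    have hs : (1 / Real.sqrt 2) ^ 2 = 1 / 2 := by
      rw [div_pow, Real.sq_sqrt (by norm_num), one_pow]
    have := pow_le_pow_left₀ (by positivity) hξ₁ 2
    linarith
  rw [(hasDerivAt_nPoly ω₀ r β ω γ).deriv] at h₂
  unfold nPoly at h₁
  by_cases hω : ω = 0
  · subst hω
    have h : r ^ 4 * ω₀ ^ 4 * (γ ^ 2 - 1) = 0 := by linear_combination h₁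
    have hpos : r ^ 4 * ω₀ ^ 4 ≠ 0 := by positivity
    exact ⟨rfl, sub_eq_zero.1 ((mul_eq_zero.1 h).resolve_left hpos)⟩
  · have hd := (mul_eq_zero.1 h₂).resolve_left (by simpa using hω)
    have hr2 : r ^ 2 ≠ 1 := by
      rw [Ne, pow_eq_one_iff_of_nonneg hr.le two_ne_zero]
      exact hr1
    refine (no_pos_double_root (g := γ ^ 2) (pow_pos hr 2) hr2 (pow_pos hω₀ 2) hβ0
      (by positivity : 0 < ω ^ 2) ?_ ?_).elim
    · linear_combination hd
    · linear_combination 2 * ω ^ 2 * hd - h₁
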